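/- For every τ in the complex upper half-plane with q = e^{2πiτ}, and every nonzero complex number w with w ≠ q^n for all integers n, one has g_3(w;q) = (1/(q;q)_∞) · Σ_{n∈ℤ} (−1)^n q^{3n(n+1)/2}/(1 − w q^n). -/

import Mathlib

open Complex

noncomputable section

/-- Finite q-Pochhammer symbol `(a;q)_n`. -/
def qPoch (a q : ℂ) (n : ℕ) : ℂ := ∏ j ∈ Finset.range n, (1 - a * q ^ j)

/-- Infinite q-Pochhammer symbol `(a;q)_∞`. -/
def qPochInf (a q : ℂ) : ℂ := ∏' j : ℕ, (1 - a * q ^ j)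

/-- Jacobi theta function `θ(z;τ)`. -/
def theta (z τ : ℂ) : ℂ :=
  ∑' n : ℤ, (-1 : ℂ) ^ n * Complex.exp (Real.pi * Complex.I * (2 * n + 1) * z) *
    Complex.exp (2 * Real.pi * Complex.I * τ * ((n : ℂ) * (n + 1) / 2 + 1 / 8))

/-- Zwegers' mock Jacobi form `μ(u,v;τ)`. -/
def mu (u v τ : ℂ) : ℂ :=
  Complex.exp (Real.pi * Complex.I * u) / theta v τ *
    ∑' n : ℤ, (-Complex.exp (2 * Real.pi * Complex.I * v)) ^ n *
      Complex.exp (Real.pi * Complex.I * τ * n * (n + 1)) /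
      (1 - Complex.exp (2 * Real.pi * Complex.I * u) *
        Complex.exp (2 * Real.pi * Complex.I * τ) ^ n)

/-- Dedekind eta function `η(τ)`. -/
def eta (τ : ℂ) : ℂ :=
  Complex.exp (Real.pi * Complex.I * τ / 12) *
    ∏' n : ℕ, (1 - Complex.exp (2 * Real.pi * Complex.I * τ * (n + 1)))

/-- Universal mock theta function `g₂(w;q)`. -/
def g2 (w q : ℂ) : ℂ :=
  ∑' n : ℕ, qPoch (-q) q n * q ^ (n * (n + 1) / 2) /
    (qPoch w q (n + 1) * qPoch (q / w) q (n + 1))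

/-- Universal mock theta function `g₃(w;q)`. -/
def g3 (w q : ℂ) : ℂ :=
  ∑' n : ℕ, q ^ (n * (n + 1)) / (qPoch w q (n + 1) * qPoch (q / w) q (n + 1))

/-- Rank generating function `𝓡(w;q)`. -/
def rankGF (w q : ℂ) : ℂ :=
  ∑' n : ℕ, q ^ (n ^ 2) / ∏ k ∈ Finset.range n, ((1 - w * q ^ (k + 1)) * (1 - q ^ (k + 1) / w))

/-- Crank generating function `𝓒(w;q)`. -/
def crankGF (w q : ℂ) : ℂ := qPochInf q q / (qPochInf (w * q) q * qPochInf (q / w) q)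

/-- The series `K'(w;τ)` with `q = e^{2πiτ}`. -/
def Kp (w q : ℂ) : ℂ :=
  ∑' n : ℕ, (-1 : ℂ) ^ n * q ^ (n ^ 2) * qPoch q (q ^ 2) n /
    (qPoch (w * q ^ 2) (q ^ 2) n * qPoch (q ^ 2 / w) (q ^ 2) n)

/-- The series `K''(w;τ)` with `q = e^{2πiτ}` (the sum starts at `n = 1`). -/
def Kpp (w q : ℂ) : ℂ :=
  ∑' n : ℕ, (-1 : ℂ) ^ (n + 1) * q ^ ((n + 1) ^ 2) * qPoch q (q ^ 2) n /
    (qPoch (w * q) (q ^ 2) (n + 1) * qPoch (q / w) (q ^ 2) (n + 1))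

/-- The series `ρ(a,b,c)` from the three variable reciprocity theorem. -/
def rho (a b c q : ℂ) : ℂ :=
  (1 + 1 / b) * ∑' n : ℕ, qPoch c q n * (-1 : ℂ) ^ n * q ^ (n * (n + 1) / 2) * (a / b) ^ n /
    (qPoch (-a * q) q n * qPoch (-c / b) q (n + 1))

/-- The coefficient `(-1)^j q^{j(j+1)/2}`. -/
def triCoeff (q : ℂ) (j : ℤ) : ℂ := (-1 : ℂ) ^ j * q ^ (j * (j + 1) / 2)

/-- The reciprocal `1/(q;q)_k`, extended by zero to negative `k`. -/
def invPoch (q : ℂ) (k : ℤ) : ℂ := if 0 ≤ k then (qPoch q q k.toNat)⁻¹ else 0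

lemma triangle_succ (j : ℤ) : (j + 1) * (j + 1 + 1) / 2 = j * (j + 1) / 2 + (j + 1) := by
  rw [show (j + 1) * (j + 1 + 1) = j * (j + 1) + (j + 1) * 2 by ring,
    Int.add_mul_ediv_right _ _ two_ne_zero]

lemma triCoeff_succ {q : ℂ} (hq0 : q ≠ 0) (j : ℤ) :
    triCoeff q (j + 1) = -(q ^ (j + 1) * triCoeff q j) := by
  rw [triCoeff, triCoeff, triangle_succ, zpow_add₀ hq0, zpow_add₀ (by norm_num : (-1 : ℂ) ≠ 0),
    zpow_one]
  ring

lemma triCoeff_eq_neg {q : ℂ} (hq0 : q ≠ 0) (j : ℤ) :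
    triCoeff q j = -(q ^ j * triCoeff q (j - 1)) := by
  simpa using triCoeff_succ hq0 (j - 1)

lemma triCoeff_reflect (q : ℂ) (j : ℤ) : triCoeff q (-1 - j) = -triCoeff q j := by
  rw [triCoeff, triCoeff, show (-1 - j) * (-1 - j + 1) = j * (j + 1) by ring,
    zpow_sub₀ (by norm_num : (-1 : ℂ) ≠ 0), div_eq_mul_inv, ← inv_zpow]
  norm_num

lemma one_sub_zpow_ne_zero {q : ℂ} (hq0 : q ≠ 0) (hq1 : ‖q‖ < 1) {k : ℤ} (hk : 0 < k) :
    1 - q ^ k ≠ 0 := by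
  intro h
  have h1 : ‖q‖ ^ k = 1 := by rw [← norm_zpow, ← sub_eq_zero.1 h, norm_one]
  exact (zpow_lt_one₀ (norm_pos_iff.2 hq0) hq1 hk).ne h1

lemma qPoch_succ (a q : ℂ) (n : ℕ) : qPoch a q (n + 1) = qPoch a q n * (1 - a * q ^ n) :=
  Finset.prod_range_succ _ _

lemma invPoch_of_neg (q : ℂ) {k : ℤ} (hk : k < 0) : invPoch q k = 0 := if_neg (by omega)

lemma invPoch_natCast (q : ℂ) (n : ℕ) : invPoch q n = (qPoch q q n)⁻¹ := by simp [invPoch]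

lemma invPoch_zero (q : ℂ) : invPoch q 0 = 1 := by simp [invPoch, qPoch]

lemma invPoch_sub_one {q : ℂ} (hq0 : q ≠ 0) (hq1 : ‖q‖ < 1) (k : ℤ) :
    invPoch q (k - 1) = (1 - q ^ k) * invPoch q k := by
  rcases lt_trichotomy k 0 with hk | rfl | hk
  · rw [invPoch_of_neg q hk, invPoch_of_neg q (by omega), mul_zero]
  · rw [invPoch_of_neg q (by omega), zpow_zero, sub_self, zero_mul]
  · obtain ⟨n, rfl⟩ : ∃ n : ℕ, k = (n + 1 : ℕ) := ⟨(k - 1).toNat, by omega⟩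
    have h := one_sub_zpow_ne_zero hq0 hq1 hk
    rw [show ((n + 1 : ℕ) : ℤ) - 1 = (n : ℕ) by push_cast; ring, invPoch_natCast,
      invPoch_natCast, qPoch_succ]
    rw [zpow_natCast] at h ⊢
    rw [← pow_succ', mul_inv]
    field_simp

lemma summable_mul_invPoch (q : ℂ) (f : ℤ → ℂ) (a b : ℤ) :
    Summable fun j : ℤ => f j * (invPoch q (a - j) * invPoch q (b + j)) := by
  refine summable_of_hasFiniteSupport ((Set.finite_Icc (-b) a).subset fun j hj => ?_)
  by_contra h
  refine hj ?_
  rw [Set.mem_Icc, not_and_or] at h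
  rcases h with h | h
  · simp only [invPoch_of_neg q (show b + j < 0 by omega), mul_zero]
  · simp only [invPoch_of_neg q (show a - j < 0 by omega), mul_zero, zero_mul]

/-- A two-parameter alternating `q`-binomial sum. -/
def altSum (q : ℂ) (a b : ℤ) : ℂ :=
  ∑' j : ℤ, triCoeff q (j - 1) * (invPoch q (a - j) * invPoch q (b + j))

lemma altSum_eq_shift (q : ℂ) (a b : ℤ) :
    ∑' j : ℤ, triCoeff q j * (invPoch q (a - j) * invPoch q (b + j)) =
      altSum q (a + 1) (b - 1) := by
  conv_rhs => rw [altSum, ← (Equiv.addRight (1 : ℤ)).tsum_eq]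
  refine tsum_congr fun j => ?_
  simp only [Equiv.coe_addRight]
  ring_nf

lemma altSum_sub_one (q : ℂ) (a : ℤ) : altSum q a (a - 1) = 0 := by
  have h : altSum q a (a - 1) = -altSum q a (a - 1) := by
    conv_lhs => rw [altSum, ← (Equiv.subLeft (1 : ℤ)).tsum_eq]
    rw [altSum, ← tsum_neg]
    refine tsum_congr fun j => ?_
    rw [Equiv.subLeft_apply, show 1 - j - 1 = -1 - (j - 1) by ring, triCoeff_reflect,
      show a - (1 - j) = a - 1 + j by ring, show a - 1 + (1 - j) = a - j by ring]
    ring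
  exact self_eq_neg.1 h

lemma altSum_rec {q : ℂ} (hq0 : q ≠ 0) (hq1 : ‖q‖ < 1) (a b : ℤ) :
    (1 - q ^ (a + b)) * altSum q a b = (1 - q ^ b) * altSum q a (b - 1) := by
  have h1 : (1 - q ^ (a + b)) * altSum q a b = altSum q a (b - 1) -
      q ^ b * ∑' j : ℤ, triCoeff q j * (invPoch q (a - 1 - j) * invPoch q (b + j)) := by
    rw [altSum, altSum, ← tsum_mul_left, ← tsum_mul_left,
      ← (summable_mul_invPoch q _ a (b - 1)).tsum_sub
        ((summable_mul_invPoch q _ (a - 1) b).mul_left _)]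
    refine tsum_congr fun j => ?_
    rw [show b - 1 + j = b + j - 1 by ring, show a - 1 - j = a - j - 1 by ring,
      invPoch_sub_one hq0 hq1 (b + j), invPoch_sub_one hq0 hq1 (a - j), triCoeff_eq_neg hq0 j,
      zpow_add₀ hq0, zpow_add₀ hq0, zpow_sub₀ hq0]
    field_simp
    ring
  rw [h1, altSum_eq_shift, sub_add_cancel]
  ring

lemma altSum_eq_zero {q : ℂ} (hq0 : q ≠ 0) (hq1 : ‖q‖ < 1) {a b : ℤ} (h : 0 < a + b)
    (hb : altSum q a (b - 1) = 0) : altSum q a b = 0 := by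
  have := altSum_rec hq0 hq1 a b
  rw [hb, mul_zero] at this
  exact (mul_eq_zero.1 this).resolve_left (one_sub_zpow_ne_zero hq0 hq1 h)

/-- The partial fraction expansion with simple poles at `w = q^{-j}`, `-N-1 ≤ j ≤ N`. -/
def partialFrac (w q : ℂ) (N : ℤ) : ℂ :=
  ∑' j : ℤ, triCoeff q j * (1 - w * q ^ j)⁻¹ * (invPoch q (N - j) * invPoch q (N + 1 + j))

lemma partialFrac_rec {w q : ℂ} (hq0 : q ≠ 0) (hq1 : ‖q‖ < 1) (hw0 : w ≠ 0)
    (hw : ∀ j : ℤ, 1 - w * q ^ j ≠ 0) {M : ℤ} (hM : 0 < M) :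
    (1 - w * q ^ M) * (1 - q ^ (M + 1) / w) * partialFrac w q M = partialFrac w q (M - 1) := by
  have h1 : ∑' j : ℤ, triCoeff q (j - 1) * (invPoch q (M - j) * invPoch q (M + 1 + j)) = 0 := by
    refine altSum_eq_zero hq0 hq1 (by omega) (altSum_eq_zero hq0 hq1 (by omega) ?_)
    rw [add_sub_cancel_right, altSum_sub_one]
  have h2 : ∑' j : ℤ, triCoeff q j * (invPoch q (M - j) * invPoch q (M + 1 + j)) = 0 := by
    rw [altSum_eq_shift, altSum_sub_one]
  have key : (1 - w * q ^ M) * (1 - q ^ (M + 1) / w) * partialFrac w q M =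
      partialFrac w q (M - 1)
      - q ^ M * ∑' j : ℤ, triCoeff q (j - 1) * (invPoch q (M - j) * invPoch q (M + 1 + j))
      - q ^ (M + 1) / w *
        ∑' j : ℤ, triCoeff q j * (invPoch q (M - j) * invPoch q (M + 1 + j)) := by
    rw [partialFrac, partialFrac, ← tsum_mul_left, ← tsum_mul_left, ← tsum_mul_left,
      ← (summable_mul_invPoch q _ (M - 1) (M - 1 + 1)).tsum_sub
        ((summable_mul_invPoch q _ M (M + 1)).mul_left _),
      ← ((summable_mul_invPoch q _ (M - 1) (M - 1 + 1)).sub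
        ((summable_mul_invPoch q _ M (M + 1)).mul_left _)).tsum_sub
        ((summable_mul_invPoch q _ M (M + 1)).mul_left _)]
    refine tsum_congr fun j => ?_
    rw [show M - 1 - j = M - j - 1 by ring, show M - 1 + 1 + j = M + 1 + j - 1 by ring,
      invPoch_sub_one hq0 hq1 (M + 1 + j), invPoch_sub_one hq0 hq1 (M - j),
      triCoeff_eq_neg hq0 j, zpow_add₀ hq0 (M + 1) j, zpow_add₀ hq0 M 1, zpow_sub₀ hq0, zpow_one]
    have := hw j
    have := zpow_ne_zero j hq0
    field_simp
    ring
  rw [key, h1, h2]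
  ring

lemma partialFrac_zero {w q : ℂ} (hq0 : q ≠ 0) (hq1 : ‖q‖ < 1) (hw0 : w ≠ 0)
    (hw : ∀ j : ℤ, 1 - w * q ^ j ≠ 0) :
    (1 - w) * (1 - q / w) * partialFrac w q 0 = 1 := by
  rw [partialFrac, tsum_eq_sum (s := {-1, 0})]
  · have h1 : 1 - q ≠ 0 := by simpa using one_sub_zpow_ne_zero hq0 hq1 one_pos
    have h2 : invPoch q 1 = (1 - q)⁻¹ := by simp [invPoch, qPoch]
    have h3 : 1 - w ≠ 0 := by simpa using hw 0
    have h4 : q - w ≠ 0 := by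
      have := mul_ne_zero hq0 (hw (-1))
      rwa [zpow_neg_one, mul_sub, mul_one, mul_left_comm, mul_inv_cancel₀ hq0, mul_one] at this
    rw [Finset.sum_pair (by norm_num)]
    norm_num [triCoeff, invPoch_zero, h2]
    have h5 : 1 - w / q ≠ 0 := by simpa [div_eq_mul_inv] using hw (-1)
    rw [show 1 - w * q⁻¹ = (q - w) / q by field_simp]
    field_simp
    ring
  · intro j hj
    simp only [Finset.mem_insert, Finset.mem_singleton, not_or] at hj
    rcases lt_or_ge j 0 with h | h
    · rw [invPoch_of_neg q (show 0 + 1 + j < 0 by omega), mul_zero, mul_zero]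
    · rw [invPoch_of_neg q (show 0 - j < 0 by omega), zero_mul, mul_zero]

lemma partialFrac_natCast {w q : ℂ} (hq0 : q ≠ 0) (hq1 : ‖q‖ < 1) (hw0 : w ≠ 0)
    (hw : ∀ j : ℤ, 1 - w * q ^ j ≠ 0) (n : ℕ) :
    qPoch w q (n + 1) * qPoch (q / w) q (n + 1) * partialFrac w q n = 1 := by
  induction n with
  | zero => simpa [qPoch] using partialFrac_zero hq0 hq1 hw0 hw
  | succ n ih =>
    have h := partialFrac_rec hq0 hq1 hw0 hw (M := (n + 1 : ℕ)) (by omega)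
    rw [show ((n + 1 : ℕ) : ℤ) - 1 = n by push_cast; ring] at h
    rw [← ih, ← h, qPoch_succ w q (n + 1), qPoch_succ (q / w) q (n + 1), zpow_add₀ hq0,
      zpow_natCast, zpow_one]
    ring

lemma summable_norm_pow_succ {q : ℂ} (hq1 : ‖q‖ < 1) : Summable fun n : ℕ => ‖-(q * q ^ n)‖ := by
  simpa only [norm_neg, norm_mul, norm_pow] using
    (summable_geometric_of_lt_one (norm_nonneg q) hq1).mul_left ‖q‖

lemma tendsto_qPoch {q : ℂ} (hq1 : ‖q‖ < 1) :
    Filter.Tendsto (qPoch q q) Filter.atTop (nhds (qPochInf q q)) := by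
  have h := (multipliable_one_add_of_summable (summable_norm_pow_succ hq1)).tendsto_prod_tprod_nat
  simp only [← sub_eq_add_neg] at h
  exact h

lemma qPochInf_ne_zero {q : ℂ} (hq0 : q ≠ 0) (hq1 : ‖q‖ < 1) : qPochInf q q ≠ 0 := by
  have h := tprod_one_add_ne_zero_of_summable (f := fun n : ℕ => -(q * q ^ n))
    (fun n => ?_) (summable_norm_pow_succ hq1)
  · simp only [← sub_eq_add_neg] at h
    exact h
  · have := one_sub_zpow_ne_zero hq0 hq1 (k := (n + 1 : ℕ)) (by omega)
    rwa [zpow_natCast, pow_succ', sub_eq_add_neg] at this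

lemma tendsto_invPoch {q : ℂ} (hq0 : q ≠ 0) (hq1 : ‖q‖ < 1) :
    Filter.Tendsto (fun n : ℕ => invPoch q n) Filter.atTop (nhds (qPochInf q q)⁻¹) := by
  simpa only [invPoch_natCast] using (tendsto_qPoch hq1).inv₀ (qPochInf_ne_zero hq0 hq1)

lemma exists_norm_le_of_tendsto {u : ℕ → ℂ} {l : ℂ}
    (h : Filter.Tendsto u Filter.atTop (nhds l)) : ∃ C : ℝ, ∀ n, ‖u n‖ ≤ C := by
  obtain ⟨C, hC⟩ := (Metric.isBounded_range_of_tendsto u h).exists_norm_le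
  exact ⟨C, fun n => hC _ ⟨n, rfl⟩⟩

lemma exists_norm_invPoch_le {q : ℂ} (hq0 : q ≠ 0) (hq1 : ‖q‖ < 1) :
    ∃ C : ℝ, ∀ k, ‖invPoch q k‖ ≤ C := by
  obtain ⟨C, hC⟩ := exists_norm_le_of_tendsto (tendsto_invPoch hq0 hq1)
  refine ⟨C, fun k => ?_⟩
  rcases lt_or_ge k 0 with hk | hk
  · rw [invPoch_of_neg q hk, norm_zero]
    exact (norm_nonneg _).trans (hC 0)
  · lift k to ℕ using hk
    exact hC k

lemma exists_norm_inv_one_sub_le {w q : ℂ} (hq0 : q ≠ 0) (hq1 : ‖q‖ < 1) (hw0 : w ≠ 0) :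
    ∃ C : ℝ, ∀ j : ℤ, ‖(1 - w * q ^ j)⁻¹‖ ≤ C := by
  have hq := tendsto_pow_atTop_nhds_zero_of_norm_lt_one hq1
  have h1 : Filter.Tendsto (fun n : ℕ => (1 - w * q ^ n)⁻¹) Filter.atTop (nhds 1) := by
    simpa using ((hq.const_mul w).const_sub 1).inv₀ (by simp)
  have h2 : Filter.Tendsto (fun n : ℕ => q ^ n * (q ^ n - w)⁻¹) Filter.atTop (nhds 0) := by
    simpa using hq.mul ((hq.sub_const w).inv₀ (by simpa using hw0))
  obtain ⟨C, hC⟩ := exists_norm_le_of_tendsto h1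
  obtain ⟨D, hD⟩ := exists_norm_le_of_tendsto h2
  refine ⟨max C D, fun j => ?_⟩
  obtain ⟨n, rfl | rfl⟩ := j.eq_nat_or_neg
  · rw [zpow_natCast]
    exact (hC n).trans (le_max_left _ _)
  · have hn : q ^ n ≠ 0 := pow_ne_zero n hq0
    rw [zpow_neg, zpow_natCast, show 1 - w * (q ^ n)⁻¹ = (q ^ n - w) / q ^ n by field_simp,
      inv_div, div_eq_mul_inv]
    exact (hD n).trans (le_max_right _ _)

/-- The `m`-th term of the Durfee rectangle series with excess `a`. -/
def durfeeTerm (q : ℂ) (a m : ℕ) : ℂ :=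
  q ^ (m * m + a * m) * (invPoch q m * invPoch q (m + a : ℕ))

lemma norm_pow_mul_invPoch_le {q : ℂ} (hq1 : ‖q‖ < 1) {C : ℝ} (hC : ∀ k, ‖invPoch q k‖ ≤ C)
    {m e : ℕ} (h : m ≤ e) (k l : ℤ) :
    ‖q ^ e * (invPoch q k * invPoch q l)‖ ≤ ‖q‖ ^ m * (C * C) := by
  have hC0 : 0 ≤ C := (norm_nonneg _).trans (hC 0)
  rw [norm_mul, norm_mul, norm_pow]
  gcongr ?_ * (?_ * ?_)
  · exact pow_le_pow_of_le_one (norm_nonneg q) hq1.le h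
  · exact hC k
  · exact hC l

lemma summable_geometric_mul {q : ℂ} (hq1 : ‖q‖ < 1) (C : ℝ) :
    Summable fun m : ℕ => ‖q‖ ^ m * C :=
  (summable_geometric_of_lt_one (norm_nonneg q) hq1).mul_right C

lemma norm_durfeeTerm_le {q : ℂ} (hq1 : ‖q‖ < 1) {C : ℝ} (hC : ∀ k, ‖invPoch q k‖ ≤ C)
    (a m : ℕ) : ‖durfeeTerm q a m‖ ≤ ‖q‖ ^ m * (C * C) :=
  norm_pow_mul_invPoch_le hq1 hC (le_add_right (Nat.le_mul_self m)) _ _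

lemma summable_durfeeTerm {q : ℂ} (hq0 : q ≠ 0) (hq1 : ‖q‖ < 1) (a : ℕ) :
    Summable (durfeeTerm q a) := by
  obtain ⟨C, hC⟩ := exists_norm_invPoch_le hq0 hq1
  exact .of_norm_bounded (summable_geometric_mul hq1 _) (norm_durfeeTerm_le hq1 hC a)

lemma durfee_diff {q : ℂ} (hq0 : q ≠ 0) (hq1 : ‖q‖ < 1) (a : ℕ) :
    ∑' m, durfeeTerm q a m - ∑' m, durfeeTerm q (a + 1) m =
      q ^ (a + 1) * (∑' m, durfeeTerm q (a + 2) m - ∑' m, durfeeTerm q (a + 1) m) := by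
  have hs := summable_durfeeTerm hq0 hq1
  let f : ℕ → ℂ := fun m =>
    q ^ (m * m + a * m) * (invPoch q ((m : ℤ) - 1) * invPoch q (m + (a + 1) : ℕ))
  have hf : ∀ m, f m = durfeeTerm q a m - durfeeTerm q (a + 1) m
      + q ^ (a + 1) * durfeeTerm q (a + 1) m := by
    intro m
    have h1 := invPoch_sub_one hq0 hq1 m
    have h2 := invPoch_sub_one hq0 hq1 (m + (a + 1) : ℕ)
    rw [show ((m + (a + 1) : ℕ) : ℤ) - 1 = (m + a : ℕ) by push_cast; ring] at h2
    simp only [f, durfeeTerm]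
    rw [h1, h2, zpow_natCast, zpow_natCast]
    ring
  have hfs : Summable f :=
    (((hs a).sub (hs (a + 1))).add ((hs (a + 1)).mul_left _)).congr fun m => (hf m).symm
  have h1 : ∑' m, f m = ∑' m, durfeeTerm q a m - ∑' m, durfeeTerm q (a + 1) m
      + q ^ (a + 1) * ∑' m, durfeeTerm q (a + 1) m := by
    rw [tsum_congr hf, ((hs a).sub (hs (a + 1))).tsum_add ((hs (a + 1)).mul_left _),
      (hs a).tsum_sub (hs (a + 1)), tsum_mul_left]
  have h2 : ∑' m, f m = q ^ (a + 1) * ∑' m, durfeeTerm q (a + 2) m := by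
    rw [hfs.tsum_eq_zero_add, ← tsum_mul_left]
    have h0 : f 0 = 0 := by simp [f, invPoch_of_neg]
    rw [h0, zero_add]
    refine tsum_congr fun m => ?_
    simp only [f, durfeeTerm]
    rw [show ((m + 1 : ℕ) : ℤ) - 1 = m by push_cast; ring,
      show m + 1 + (a + 1) = m + (a + 2) by ring]
    ring
  linear_combination h2 - h1

lemma durfee_succ {q : ℂ} (hq0 : q ≠ 0) (hq1 : ‖q‖ < 1) (a : ℕ) :
    ∑' m, durfeeTerm q (a + 1) m = ∑' m, durfeeTerm q a m := by
  obtain ⟨C, hC⟩ := exists_norm_invPoch_le hq0 hq1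
  let A : ℕ → ℂ := fun a => ∑' m, durfeeTerm q a m
  let B : ℝ := ∑' m : ℕ, ‖q‖ ^ m * (C * C)
  have hA : ∀ a, ‖A a‖ ≤ B := fun a =>
    tsum_of_norm_bounded (summable_geometric_mul hq1 _).hasSum (norm_durfeeTerm_le hq1 hC a)
  have hstep : ∀ a, ‖A a - A (a + 1)‖ ≤ ‖q‖ * ‖A (a + 1) - A (a + 2)‖ := by
    intro a
    rw [show A a - A (a + 1) = q ^ (a + 1) * (A (a + 2) - A (a + 1)) from durfee_diff hq0 hq1 a,
      norm_mul, norm_pow, norm_sub_rev (A (a + 2))]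
    gcongr
    exact pow_le_of_le_one (norm_nonneg q) hq1.le a.succ_ne_zero
  have hpow : ∀ n a, ‖A a - A (a + 1)‖ ≤ ‖q‖ ^ n * (B + B) := by
    intro n
    induction n with
    | zero =>
      intro a
      rw [pow_zero, one_mul]
      exact (norm_sub_le _ _).trans (add_le_add (hA a) (hA (a + 1)))
    | succ n ih =>
      intro a
      rw [pow_succ', mul_assoc]
      exact (hstep a).trans (mul_le_mul_of_nonneg_left (ih (a + 1)) (norm_nonneg q))
  have hlim : Filter.Tendsto (fun n : ℕ => ‖q‖ ^ n * (B + B)) Filter.atTop (nhds 0) := by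
    simpa using (tendsto_pow_atTop_nhds_zero_of_lt_one (norm_nonneg q) hq1).mul_const (B + B)
  have h0 := ge_of_tendsto' hlim fun n => hpow n a
  exact (sub_eq_zero.1 (norm_le_zero_iff.1 h0)).symm

/-- The Durfee rectangle identity `∑ q^{m² + am} / ((q)_m (q)_{m+a}) = 1 / (q)_∞`. -/
lemma tsum_durfeeTerm {q : ℂ} (hq0 : q ≠ 0) (hq1 : ‖q‖ < 1) (a : ℕ) :
    ∑' m, durfeeTerm q a m = (qPochInf q q)⁻¹ := by
  obtain ⟨C, hC⟩ := exists_norm_invPoch_le hq0 hq1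
  have hconst : ∀ b, ∑' m, durfeeTerm q b m = ∑' m, durfeeTerm q 0 m := by
    intro b
    induction b with
    | zero => rfl
    | succ b ih => rw [durfee_succ hq0 hq1, ih]
  have hlim : Filter.Tendsto (fun b => ∑' m, durfeeTerm q b m) Filter.atTop
      (nhds (∑' m : ℕ, if m = 0 then (qPochInf q q)⁻¹ else 0)) := by
    refine tendsto_tsum_of_dominated_convergence (summable_geometric_mul hq1 (C * C)) (fun m => ?_)
      (.of_forall fun b m => norm_durfeeTerm_le hq1 hC b m)
    rcases eq_or_ne m 0 with rfl | hm
    · simpa [durfeeTerm, invPoch_zero] using tendsto_invPoch hq0 hq1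
    · rw [if_neg hm]
      have hb : ∀ b, ‖durfeeTerm q b m‖ ≤ ‖q‖ ^ b * (C * C) := fun b =>
        norm_pow_mul_invPoch_le hq1 hC
          (le_add_left (Nat.le_mul_of_pos_right b (Nat.pos_of_ne_zero hm))) _ _
      refine squeeze_zero_norm hb ?_
      simpa using (tendsto_pow_atTop_nhds_zero_of_lt_one (norm_nonneg q) hq1).mul_const (C * C)
  rw [tsum_ite_eq] at hlim
  rw [hconst a]
  refine tendsto_nhds_unique ?_ hlim
  simp only [hconst, tendsto_const_nhds]

lemma tsum_baileyTerm_natCast {q : ℂ} (hq0 : q ≠ 0) (hq1 : ‖q‖ < 1) (k : ℕ) :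
    ∑' n : ℕ, q ^ (n * (n + 1)) * (invPoch q (n - k) * invPoch q (n + 1 + k)) =
      q ^ (k * (k + 1)) * (qPochInf q q)⁻¹ := by
  obtain ⟨C, hC⟩ := exists_norm_invPoch_le hq0 hq1
  have hs : Summable fun n : ℕ =>
      q ^ (n * (n + 1)) * (invPoch q (n - k) * invPoch q (n + 1 + k)) :=
    .of_norm_bounded (summable_geometric_mul hq1 (C * C)) fun n =>
      norm_pow_mul_invPoch_le hq1 hC (Nat.le_mul_of_pos_right n n.succ_pos) _ _
  rw [← hs.sum_add_tsum_nat_add k, Finset.sum_eq_zero, zero_add,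
    ← tsum_durfeeTerm hq0 hq1 (2 * k + 1), ← tsum_mul_left]
  · refine tsum_congr fun m => ?_
    rw [durfeeTerm, show ((m + k : ℕ) : ℤ) - k = m by push_cast; ring,
      show ((m + k : ℕ) : ℤ) + 1 + k = (m + (2 * k + 1) : ℕ) by push_cast; ring]
    ring
  · intro n hn
    rw [invPoch_of_neg q (by have := Finset.mem_range.1 hn; omega), zero_mul, mul_zero]

lemma tsum_baileyTerm {q : ℂ} (hq0 : q ≠ 0) (hq1 : ‖q‖ < 1) (j : ℤ) :
    ∑' n : ℕ, q ^ (n * (n + 1)) * (invPoch q (n - j) * invPoch q (n + 1 + j)) =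
      q ^ (j * (j + 1)) * (qPochInf q q)⁻¹ := by
  rcases lt_or_ge j 0 with hj | hj
  · obtain ⟨k, rfl⟩ : ∃ k : ℕ, j = -1 - k := ⟨(-1 - j).toNat, by omega⟩
    rw [show (-1 - (k : ℤ)) * (-1 - k + 1) = (k * (k + 1) : ℕ) by push_cast; ring, zpow_natCast,
      ← tsum_baileyTerm_natCast hq0 hq1 k]
    refine tsum_congr fun n => ?_
    rw [show (n : ℤ) - (-1 - k) = n + 1 + k by ring, show (n : ℤ) + 1 + (-1 - k) = n - k by ring]
    ring
  · lift j to ℕ using hj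
    rw [tsum_baileyTerm_natCast hq0 hq1 j]
    norm_cast

lemma summable_norm_triCoeff {q : ℂ} (hq1 : ‖q‖ < 1) : Summable fun j : ℤ => ‖triCoeff q j‖ := by
  have h : Summable fun n : ℕ => ‖triCoeff q n‖ := by
    refine .of_nonneg_of_le (fun n => norm_nonneg _) (fun n => ?_)
      (summable_geometric_of_lt_one (norm_nonneg q) hq1)
    have hn : n ≤ n * (n + 1) / 2 := by
      rw [Nat.le_div_iff_mul_le two_pos]
      rcases n.eq_zero_or_pos with rfl | h
      · simp
      · exact Nat.mul_le_mul_left n (by omega)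
    rw [triCoeff, show (n : ℤ) * (n + 1) / 2 = (n * (n + 1) / 2 : ℕ) by push_cast; rfl,
      zpow_natCast, zpow_natCast, norm_mul, norm_pow, norm_pow, norm_neg, norm_one, one_pow, one_mul]
    exact pow_le_pow_of_le_one (norm_nonneg q) hq1.le hn
  refine .of_nat_of_neg_add_one h (h.congr fun n => ?_)
  rw [show -((n : ℤ) + 1) = -1 - n by ring, triCoeff_reflect, norm_neg]

lemma triCoeff_mul_zpow {q : ℂ} (hq0 : q ≠ 0) (j : ℤ) :
    triCoeff q j * q ^ (j * (j + 1)) = (-1 : ℂ) ^ j * q ^ (3 * j * (j + 1) / 2) := by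
  rw [triCoeff, mul_assoc, ← zpow_add₀ hq0,
    show 3 * j * (j + 1) = j * (j + 1) + j * (j + 1) * 2 by ring,
    Int.add_mul_ediv_right _ _ two_ne_zero]

lemma g3_eq_lambert {w q : ℂ} (hq0 : q ≠ 0) (hq1 : ‖q‖ < 1) (hw0 : w ≠ 0)
    (hw : ∀ j : ℤ, 1 - w * q ^ j ≠ 0) :
    g3 w q = (1 / qPochInf q q) *
      ∑' n : ℤ, (-1 : ℂ) ^ n * q ^ (3 * n * (n + 1) / 2) / (1 - w * q ^ n) := by
  obtain ⟨C, hC⟩ := exists_norm_invPoch_le hq0 hq1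
  obtain ⟨D, hD⟩ := exists_norm_inv_one_sub_le hq0 hq1 hw0
  let f : ℕ → ℤ → ℂ := fun n j => triCoeff q j * (1 - w * q ^ j)⁻¹ *
    (q ^ (n * (n + 1)) * (invPoch q (n - j) * invPoch q (n + 1 + j)))
  have hf : Summable (Function.uncurry f) := by
    refine .of_norm_bounded ((summable_geometric_mul hq1 (C * C)).mul_of_nonneg
      ((summable_norm_triCoeff hq1).mul_right D) (fun n => ?_) (fun j => ?_)) ?_
    · exact mul_nonneg (pow_nonneg (norm_nonneg q) n) (mul_self_nonneg C)
    · exact mul_nonneg (norm_nonneg _) ((norm_nonneg _).trans (hD 0))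
    · rintro ⟨n, j⟩
      rw [Function.uncurry_apply_pair, norm_mul, mul_comm, norm_mul (triCoeff q j)]
      gcongr
      · exact mul_nonneg (pow_nonneg (norm_nonneg q) n) (mul_self_nonneg C)
      · exact norm_pow_mul_invPoch_le hq1 hC (Nat.le_mul_of_pos_right n n.succ_pos) _ _
      · exact hD j
  calc g3 w q = ∑' n : ℕ, ∑' j : ℤ, f n j := by
        refine tsum_congr fun n => ?_
        have h := partialFrac_natCast hq0 hq1 hw0 hw n
        rw [div_eq_mul_inv, inv_eq_of_mul_eq_one_right h, partialFrac, ← tsum_mul_left]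
        exact tsum_congr fun j => mul_left_comm _ _ _
    _ = ∑' j : ℤ, ∑' n : ℕ, f n j := hf.tsum_comm.symm
    _ = _ := by
        rw [← tsum_mul_left]
        refine tsum_congr fun j => ?_
        rw [tsum_mul_left, tsum_baileyTerm hq0 hq1, ← triCoeff_mul_zpow hq0]
        ring

/-- the generalized Lambert series expansion of `g₃`. -/
theorem g3_lambert (τ : ℂ) (hτ : 0 < τ.im) (q : ℂ)
    (hq : q = Complex.exp (2 * Real.pi * Complex.I * τ))
    (w : ℂ) (hw0 : w ≠ 0) (hw : ∀ n : ℤ, w ≠ q ^ n) :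
    g3 w q = (1 / qPochInf q q) *
      ∑' n : ℤ, (-1 : ℂ) ^ n * q ^ (3 * n * (n + 1) / 2) / (1 - w * q ^ n) := by
  have hq0 : q ≠ 0 := hq ▸ Complex.exp_ne_zero _
  have hq1 : ‖q‖ < 1 := hq ▸ UpperHalfPlane.norm_exp_two_pi_I_lt_one ⟨τ, hτ⟩
  refine g3_eq_lambert hq0 hq1 hw0 fun j h => hw (-j) ?_
  rw [zpow_neg]
  exact eq_inv_of_mul_eq_one_left (sub_eq_zero.1 h).symm

end
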